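/- Let (X,ρ,μ) be a quasi-metric space equipped with a nonnegative Borel measure such that all ρ-balls are μ-measurable, and let s,p ∈ (0,∞) and q ∈ (0,∞]. For any u ∈ Ṁ^s_{p,q}(X,ρ,μ), one has ‖u‖_{Ṁ^s_{p,q}(X,ρ,μ)} = 0 if and only if u is constant μ-almost everywhere in X. The same statement holds with Ṁ^s_{p,q} replaced by Ṅ^s_{p,q}. -/

import Mathlib

open MeasureTheory ENNReal Set

noncomputable section

namespace HajlaszPaper

variable {X : Type*}

/-- The `ρ`-ball centered at `x` with radius `r`. -/
def qball (ρ : X → X → ℝ) (x : X) (r : ℝ) : Set X := {y | ρ x y < r}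

/-- `ρ` is a quasi-metric on `X`. -/
def IsQuasiDist (ρ : X → X → ℝ) : Prop :=
  (∀ x y, 0 ≤ ρ x y) ∧ (∀ x y, ρ x y = 0 ↔ x = y) ∧
    (∃ C₀ : ℝ, 1 ≤ C₀ ∧ ∀ x y, ρ y x ≤ C₀ * ρ x y) ∧
    (∃ C₁ : ℝ, 1 ≤ C₁ ∧ ∀ x y z, ρ x y ≤ C₁ * max (ρ x z) (ρ z y))

/-- The least admissible quasi-triangle constant `C_ρ`. -/
def Crho (ρ : X → X → ℝ) : ℝ :=
  sInf {C : ℝ | 1 ≤ C ∧ ∀ x y z : X, ρ x y ≤ C * max (ρ x z) (ρ z y)}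

/-- The least admissible quasi-symmetry constant `C̃_ρ`. -/
def CrhoTilde (ρ : X → X → ℝ) : ℝ :=
  sInf {C : ℝ | 1 ≤ C ∧ ∀ x y : X, ρ y x ≤ C * ρ x y}

/-- Two quasi-metrics are (bi-Lipschitz, i.e. pointwise) equivalent. -/
def EquivQM (ρ ϱ : X → X → ℝ) : Prop :=
  ∃ c : ℝ, 1 ≤ c ∧ ∀ x y, c⁻¹ * ϱ x y ≤ ρ x y ∧ ρ x y ≤ c * ϱ x y

variable [MeasurableSpace X]

/-- `(X, ρ, μ)` is a quasi-metric measure space. -/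
structure IsQMMS (ρ : X → X → ℝ) (μ : Measure X) : Prop where
  nontrivial : ∃ x y : X, x ≠ y
  quasi : IsQuasiDist ρ
  measurableSet_ball : ∀ (x : X) (r : ℝ), 0 < r → MeasurableSet (qball ρ x r)
  ball_pos : ∀ (x : X) (r : ℝ), 0 < r → 0 < μ (qball ρ x r)
  ball_lt_top : ∀ (x : X) (r : ℝ), 0 < r → μ (qball ρ x r) < ∞

/-- Every `μ`-measurable set is contained in a Borel (measurable) set of equal measure. -/
def BorelRegular (μ : Measure X) : Prop :=
  ∀ A : Set X, ∃ B : Set X, A ⊆ B ∧ MeasurableSet B ∧ μ A = μ B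

/-- `μ` is `Q`-doubling. -/
def QDoubling (ρ : X → X → ℝ) (μ : Measure X) (Q : ℝ) : Prop :=
  ∃ κ : ℝ, 0 < κ ∧ ∀ (x y : X) (r R : ℝ), 0 < r → r ≤ R →
    qball ρ x r ⊆ qball ρ y R →
    ENNReal.ofReal (κ * (r / R) ^ Q) * μ (qball ρ y R) ≤ μ (qball ρ x r)

/-- `μ` is doubling. -/
def DoublingMeas (ρ : X → X → ℝ) (μ : Measure X) : Prop :=
  ∃ Cd : ℝ, 0 < Cd ∧ ∀ (x : X) (r : ℝ), 0 < r →
    μ (qball ρ x (2 * r)) ≤ ENNReal.ofReal Cd * μ (qball ρ x r)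

/-- The measure density condition for `Ω`. -/
def MeasDensity (ρ : X → X → ℝ) (μ : Measure X) (Ω : Set X) : Prop :=
  ∃ c : ℝ, 0 < c ∧ ∀ x ∈ Ω, ∀ r : ℝ, 0 < r → r ≤ 1 →
    μ (qball ρ x r) ≤ ENNReal.ofReal c * μ (qball ρ x r ∩ Ω)

/-- `Ω` is locally uniformly perfect with constant `lam ∈ (0,1)`. -/
def LocUnifPerfect (ρ : X → X → ℝ) (Ω : Set X) (lam : ℝ) : Prop :=
  ∀ x ∈ Ω, ∀ r : ℝ, 0 < r → r ≤ 1 → (Ω \ qball ρ x r).Nonempty →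
    ((qball ρ x r ∩ Ω) \ qball ρ x (lam * r)).Nonempty

/-- The critical radius `φ^x_{Ω,ρ}(r)`. -/
def phiRad (ρ : X → X → ℝ) (μ : Measure X) (Ω : Set X) (x : X) (r : ℝ) : ℝ :=
  sSup {t : ℝ | 0 ≤ t ∧ t ≤ r ∧ μ (qball ρ x t ∩ Ω) ≤ μ (qball ρ x r ∩ Ω) / 2}

/-- The collection `𝔻^s_ρ(u)` of fractional `s`-gradients of `u` on `Ω`. -/
def fracGrad (ρ : X → X → ℝ) (μ : Measure X) (Ω : Set X) (s : ℝ) (u : X → ℝ) :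
    Set (ℤ → X → ℝ) :=
  {g | (∀ k x, 0 ≤ g k x) ∧ (∀ k, AEMeasurable (g k) (μ.restrict Ω)) ∧
    ∃ E : Set X, μ E = 0 ∧ ∀ k : ℤ, ∀ x ∈ Ω \ E, ∀ y ∈ Ω \ E,
      (2 : ℝ) ^ (-k - 1) ≤ ρ x y → ρ x y < (2 : ℝ) ^ (-k) →
      |u x - u y| ≤ ρ x y ^ s * (g k x + g k y)}

/-- `g` is an `s`-gradient of `u` on `S`. -/
def IsSGradOn (ρ : X → X → ℝ) (μ : Measure X) (S : Set X) (s : ℝ) (u g : X → ℝ) : Prop :=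
  (∀ x, 0 ≤ g x) ∧ AEMeasurable g (μ.restrict S) ∧
    ∃ E : Set X, μ E = 0 ∧ ∀ x ∈ S \ E, ∀ y ∈ S \ E,
      |u x - u y| ≤ ρ x y ^ s * (g x + g y)

/-- The `ℓ^q` norm (`0 < q ≤ ∞`) of a `ℤ`-indexed sequence in `[0,∞]`. -/
def lqN (q : ℝ≥0∞) (a : ℤ → ℝ≥0∞) : ℝ≥0∞ :=
  if q = ∞ then ⨆ k, a k else (∑' k, a k ^ q.toReal) ^ (1 / q.toReal)

/-- The `L^p` "norm" (`0 < p < ∞`) of a `[0,∞]`-valued function. -/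
def lpN (μ : Measure X) (p : ℝ) (f : X → ℝ≥0∞) : ℝ≥0∞ :=
  (∫⁻ x, f x ^ p ∂μ) ^ (1 / p)

/-- The `L^p` norm of `u : X → ℝ` over the set `Ω`. -/
def lpOn (μ : Measure X) (Ω : Set X) (p : ℝ) (u : X → ℝ) : ℝ≥0∞ :=
  lpN (μ.restrict Ω) p fun x => ENNReal.ofReal |u x|

/-- The homogeneous Hajłasz–Triebel–Lizorkin quasi-norm `‖u‖_{Ṁ^s_{p,q}(Ω,ρ,μ)}`. -/
def MdotNorm (ρ : X → X → ℝ) (μ : Measure X) (Ω : Set X) (s p : ℝ) (q : ℝ≥0∞)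
    (u : X → ℝ) : ℝ≥0∞ :=
  ⨅ g ∈ fracGrad ρ μ Ω s u,
    lpN (μ.restrict Ω) p fun x => lqN q fun k => ENNReal.ofReal (g k x)

/-- The homogeneous Hajłasz–Besov quasi-norm `‖u‖_{Ṅ^s_{p,q}(Ω,ρ,μ)}`. -/
def NdotNorm (ρ : X → X → ℝ) (μ : Measure X) (Ω : Set X) (s p : ℝ) (q : ℝ≥0∞)
    (u : X → ℝ) : ℝ≥0∞ :=
  ⨅ g ∈ fracGrad ρ μ Ω s u,
    lqN q fun k => lpN (μ.restrict Ω) p fun x => ENNReal.ofReal (g k x)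

/-- Membership in `M^s_{p,q}(Ω,ρ,μ)`. -/
def MemMspq (ρ : X → X → ℝ) (μ : Measure X) (Ω : Set X) (s p : ℝ) (q : ℝ≥0∞)
    (u : X → ℝ) : Prop :=
  AEMeasurable u (μ.restrict Ω) ∧ lpOn μ Ω p u ≠ ∞ ∧ MdotNorm ρ μ Ω s p q u ≠ ∞

/-- Membership in `N^s_{p,q}(Ω,ρ,μ)`. -/
def MemNspq (ρ : X → X → ℝ) (μ : Measure X) (Ω : Set X) (s p : ℝ) (q : ℝ≥0∞)
    (u : X → ℝ) : Prop :=
  AEMeasurable u (μ.restrict Ω) ∧ lpOn μ Ω p u ≠ ∞ ∧ NdotNorm ρ μ Ω s p q u ≠ ∞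

/-- The quasi-norm of `M^s_{p,q}(Ω,ρ,μ)`. -/
def MNorm (ρ : X → X → ℝ) (μ : Measure X) (Ω : Set X) (s p : ℝ) (q : ℝ≥0∞)
    (u : X → ℝ) : ℝ≥0∞ :=
  MdotNorm ρ μ Ω s p q u + lpOn μ Ω p u

/-- The quasi-norm of `N^s_{p,q}(Ω,ρ,μ)`. -/
def NNorm (ρ : X → X → ℝ) (μ : Measure X) (Ω : Set X) (s p : ℝ) (q : ℝ≥0∞)
    (u : X → ℝ) : ℝ≥0∞ :=
  NdotNorm ρ μ Ω s p q u + lpOn μ Ω p u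

/-- `s ⪯_q ind(X,ρ)` : there is a quasi-metric `ϱ ≈ ρ` with `s ≤ (log₂ C_ϱ)⁻¹`
(equivalently `C_ϱ ^ s ≤ 2`), where equality is permitted only when `q = ∞`. -/
def SPrecIndex (ρ : X → X → ℝ) (s : ℝ) (q : ℝ≥0∞) : Prop :=
  ∃ ϱ : X → X → ℝ, IsQuasiDist ϱ ∧ EquivQM ρ ϱ ∧
    (Crho ϱ ^ s < 2 ∨ (q = ∞ ∧ Crho ϱ ^ s ≤ 2))

/-- `s < ind(X,ρ)` : there is a quasi-metric `ϱ ≈ ρ` with `s < (log₂ C_ϱ)⁻¹`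
(equivalently `C_ϱ ^ s < 2`). -/
def SLtIndex (ρ : X → X → ℝ) (s : ℝ) : Prop :=
  ∃ ϱ : X → X → ℝ, IsQuasiDist ϱ ∧ EquivQM ρ ϱ ∧ Crho ϱ ^ s < 2

/-- The median value `m_u(E)`. -/
def medianVal (μ : Measure X) (E : Set X) (u : X → ℝ) : ℝ :=
  sSup {θ : ℝ | μ {x ∈ E | u x < θ} ≤ μ E / 2}

/-- `f` belongs to the homogeneous Hölder space `Ċ^α(X,ρ)`. -/
def MemHolder (ρ : X → X → ℝ) (α : ℝ) (f : X → ℝ) : Prop :=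
  ∃ H : ℝ, 0 ≤ H ∧ ∀ x y : X, |f x - f y| ≤ H * ρ x y ^ α

/-- The Hölder seminorm `‖f‖_{Ċ^α(X,ρ)}`. -/
def holderNorm (ρ : X → X → ℝ) (α : ℝ) (f : X → ℝ) : ℝ :=
  sInf {H : ℝ | 0 ≤ H ∧ ∀ x y : X, |f x - f y| ≤ H * ρ x y ^ α}

/-- The sup norm of `f`. -/
def supNorm (f : X → ℝ) : ℝ := sSup (Set.range fun x => |f x|)

/-- `ρ` is a genuine metric. -/
def IsMetricDist (ρ : X → X → ℝ) : Prop :=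
  (∀ x y, 0 ≤ ρ x y) ∧ (∀ x y, ρ x y = 0 ↔ x = y) ∧ (∀ x y, ρ x y = ρ y x) ∧
    (∀ x y z, ρ x y ≤ ρ x z + ρ z y)

/-- The homogeneous Hajłasz–Sobolev quasi-norm `‖u‖_{Ṁ^{1,p}(Ω,ρ,μ)}`. -/
def M1pDotNorm (ρ : X → X → ℝ) (μ : Measure X) (Ω : Set X) (p : ℝ) (u : X → ℝ) : ℝ≥0∞ :=
  ⨅ g ∈ {g : X → ℝ | IsSGradOn ρ μ Ω 1 u g},
    lpN (μ.restrict Ω) p fun x => ENNReal.ofReal (g x)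

/-- Membership in the Hajłasz–Sobolev space `M^{1,p}(Ω,ρ,μ)`. -/
def MemM1p (ρ : X → X → ℝ) (μ : Measure X) (Ω : Set X) (p : ℝ) (u : X → ℝ) : Prop :=
  AEMeasurable u (μ.restrict Ω) ∧ lpOn μ Ω p u ≠ ∞ ∧ M1pDotNorm ρ μ Ω p u ≠ ∞

/-- The quasi-norm of `M^{1,p}(Ω,ρ,μ)`. -/
def M1pNorm (ρ : X → X → ℝ) (μ : Measure X) (Ω : Set X) (p : ℝ) (u : X → ℝ) : ℝ≥0∞ :=
  lpOn μ Ω p u + M1pDotNorm ρ μ Ω p u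


/-- Each term of a sequence is bounded by its `ℓ^q` norm. -/
lemma le_lqN {q : ℝ≥0∞} (hq : 0 < q) (a : ℤ → ℝ≥0∞) (k : ℤ) : a k ≤ lqN q a := by
  unfold lqN
  split_ifs with h
  · exact le_iSup a k
  · rw [one_div, ENNReal.le_rpow_inv_iff (ENNReal.toReal_pos hq.ne' h)]
    exact ENNReal.le_tsum k

lemma lqN_zero {q : ℝ≥0∞} (hq : 0 < q) : lqN q (fun _ => 0) = 0 := by
  unfold lqN
  split_ifs with h
  · simp
  · have h' := ENNReal.toReal_pos hq.ne' h
    simp [ENNReal.zero_rpow_of_pos h', h']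

lemma lpN_zero (μ : Measure X) {p : ℝ} (hp : 0 < p) : lpN μ p (fun _ => 0) = 0 := by
  simp [lpN, ENNReal.zero_rpow_of_pos hp, hp]

lemma lpN_mono (μ : Measure X) {p : ℝ} (hp : 0 < p) {f g : X → ℝ≥0∞} (h : ∀ x, f x ≤ g x) :
    lpN μ p f ≤ lpN μ p g :=
  ENNReal.rpow_le_rpow
    (lintegral_mono fun x => ENNReal.rpow_le_rpow (h x) hp.le) (one_div_pos.2 hp).le

/-- The zero sequence is a fractional gradient of an a.e. constant function. -/
lemma zero_mem_fracGrad {ρ : X → X → ℝ} {μ : Measure X} {Ω : Set X} {s : ℝ} {u : X → ℝ} {c : ℝ}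
    (hu : ∀ᵐ x ∂μ, u x = c) : (fun _ _ => 0) ∈ fracGrad ρ μ Ω s u := by
  refine ⟨fun _ _ => le_rfl, fun _ => aemeasurable_const, {x | ¬u x = c}, ae_iff.1 hu, ?_⟩
  rintro k x ⟨-, hx⟩ y ⟨-, hy⟩ - -
  simp only [mem_ofPred_eq, not_not] at hx hy
  simp [hx, hy]

/-- Functions whose `L^p` quasi-norms decay fast enough tend to zero almost everywhere. -/
lemma ae_tendsto_zero_of_lpN_le {μ : Measure X} {p : ℝ} (hp : 0 < p) {f : ℕ → X → ℝ≥0∞}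
    (hf : ∀ j, AEMeasurable (f j) μ) {ε : ℕ → ℝ≥0∞} (hε : ∑' j, ε j ≠ ∞)
    (h : ∀ j, lpN μ p (f j) ≤ ε j ^ (1 / p)) :
    ∀ᵐ x ∂μ, Filter.Tendsto (fun j => f j x) Filter.atTop (nhds 0) := by
  have hint : ∀ j, ∫⁻ x, f j x ^ p ∂μ ≤ ε j := fun j =>
    (ENNReal.rpow_le_rpow_iff (one_div_pos.2 hp)).1 (h j)
  have hm : ∀ j, AEMeasurable (fun x => f j x ^ p) μ := fun j => (hf j).pow_const p
  have hsum : ∫⁻ x, ∑' j, f j x ^ p ∂μ ≠ ∞ := by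
    rw [lintegral_tsum hm]
    exact ne_top_of_le_ne_top hε (ENNReal.tsum_le_tsum hint)
  filter_upwards [ae_lt_top' (AEMeasurable.tsum hm) hsum] with x hx
  have := (ENNReal.tendsto_atTop_zero_of_tsum_ne_top hx.ne).ennrpow_const (1 / p)
  simpa [← ENNReal.rpow_mul, hp.ne', ENNReal.zero_rpow_of_pos (inv_pos.2 hp)] using this

/-- A function with fractional gradients whose entries are uniformly small in `L^p` is
a.e. constant. -/
lemma ae_const_of_small_fracGrad {ρ : X → X → ℝ} {μ : Measure X} (hρ : IsQuasiDist ρ) {s p : ℝ}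
    (hp : 0 < p) {u : X → ℝ}
    (h : ∀ ε : ℝ≥0∞, 0 < ε → ∃ g ∈ fracGrad ρ μ univ s u,
      ∀ k, lpN (μ.restrict univ) p (fun x => ENNReal.ofReal (g k x)) ≤ ε) :
    ∃ c : ℝ, ∀ᵐ x ∂μ, u x = c := by
  obtain ⟨ε, hε, hεsum⟩ := ENNReal.exists_pos_sum_of_countable' one_ne_zero ℕ
  choose g hg hgε using fun j => h (ε j ^ (1 / p))
    (ENNReal.rpow_pos (hε j) (ne_top_of_le_ne_top one_ne_top
      ((ENNReal.le_tsum j).trans hεsum.le)))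
  choose hg0 hgm E hE hgE using hg
  simp only [Measure.restrict_univ] at hgm hgε
  have hlim : ∀ᵐ x ∂μ, ∀ k, Filter.Tendsto (fun j => g j k x) Filter.atTop (nhds 0) := by
    refine ae_all_iff.2 fun k => ?_
    filter_upwards [ae_tendsto_zero_of_lpN_le hp (fun j => (hgm j k).ennreal_ofReal)
      (hεsum.trans one_lt_top).ne (fun j => hgε j k)] with x hx
    simpa [Function.comp_def, ENNReal.toReal_ofReal (hg0 _ _ _)] using
      (ENNReal.tendsto_toReal zero_ne_top).comp hx
  have hgood : ∀ᵐ x ∂μ, (∀ j, x ∉ E j) ∧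
      ∀ k, Filter.Tendsto (fun j => g j k x) Filter.atTop (nhds 0) :=
    (ae_all_iff.2 fun j => measure_eq_zero_iff_ae_notMem.1 (hE j)).and hlim
  by_cases hne : ∃ x, (∀ j, x ∉ E j) ∧
      ∀ k, Filter.Tendsto (fun j => g j k x) Filter.atTop (nhds 0)
  · obtain ⟨y, hyE, hy⟩ := hne
    refine ⟨u y, ?_⟩
    filter_upwards [hgood] with x ⟨hxE, hx⟩
    by_cases hxy : x = y
    · rw [hxy]
    have hpos : 0 < ρ x y := (hρ.1 x y).lt_of_ne fun h0 => hxy ((hρ.2.1 x y).1 h0.symm)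
    obtain ⟨n, hn₁, hn₂⟩ := exists_mem_Ico_zpow hpos (one_lt_two : (1 : ℝ) < 2)
    have hle : ∀ j, |u x - u y| ≤ ρ x y ^ s * (g j (-(n + 1)) x + g j (-(n + 1)) y) := fun j =>
      hgE j _ x ⟨mem_univ _, hxE j⟩ y ⟨mem_univ _, hyE j⟩
        (by simpa using hn₁) (by simpa only [neg_neg] using hn₂)
    have h0 := ge_of_tendsto' (((hx (-(n + 1))).add (hy (-(n + 1)))).const_mul (ρ x y ^ s)) hle
    rw [add_zero, mul_zero] at h0
    exact sub_eq_zero.1 (abs_nonpos_iff.1 h0)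
  · exact ⟨0, hgood.mono fun x hx => (hne ⟨x, hx⟩).elim⟩

/-- Proposition 2.2: the homogeneous quasi-norm of `u` vanishes iff `u` is constant
`μ`-almost everywhere; the same holds for the Besov quasi-norm. -/
theorem dotNorm_eq_zero_iff_ae_const
    {X : Type*} [MeasurableSpace X] (ρ : X → X → ℝ) (μ : Measure X)
    (hρ : IsQuasiDist ρ)
    (hball : ∀ (x : X) (r : ℝ), 0 < r → MeasurableSet (qball ρ x r))
    (s p : ℝ) (q : ℝ≥0∞) (hs : 0 < s) (hp : 0 < p) (hq : 0 < q) :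
    (∀ u : X → ℝ, AEMeasurable u μ → MdotNorm ρ μ Set.univ s p q u ≠ ∞ →
      (MdotNorm ρ μ Set.univ s p q u = 0 ↔ ∃ c : ℝ, ∀ᵐ x ∂μ, u x = c)) ∧
    (∀ u : X → ℝ, AEMeasurable u μ → NdotNorm ρ μ Set.univ s p q u ≠ ∞ →
      (NdotNorm ρ μ Set.univ s p q u = 0 ↔ ∃ c : ℝ, ∀ᵐ x ∂μ, u x = c)) := by
  refine ⟨fun u _ _ => ⟨fun h => ?_, ?_⟩, fun u _ _ => ⟨fun h => ?_, ?_⟩⟩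
  · refine ae_const_of_small_fracGrad hρ (s := s) hp fun ε hε => ?_
    obtain ⟨g, h'⟩ := iInf_lt_iff.1 (h.trans_lt hε)
    obtain ⟨hg, hgε⟩ := iInf_lt_iff.1 h'
    exact ⟨g, hg, fun k => (lpN_mono _ hp fun x =>
      le_lqN hq (fun k => ENNReal.ofReal (g k x)) k).trans hgε.le⟩
  · rintro ⟨c, hc⟩
    refine nonpos_iff_eq_zero.1 ((iInf₂_le _ (zero_mem_fracGrad hc)).trans ?_)
    simp [lqN_zero hq, lpN_zero _ hp]
  · refine ae_const_of_small_fracGrad hρ (s := s) hp fun ε hε => ?_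
    obtain ⟨g, h'⟩ := iInf_lt_iff.1 (h.trans_lt hε)
    obtain ⟨hg, hgε⟩ := iInf_lt_iff.1 h'
    exact ⟨g, hg, fun k => (le_lqN hq (fun k => lpN (μ.restrict univ) p
      fun x => ENNReal.ofReal (g k x)) k).trans hgε.le⟩
  · rintro ⟨c, hc⟩
    refine nonpos_iff_eq_zero.1 ((iInf₂_le _ (zero_mem_fracGrad hc)).trans ?_)
    simp [lqN_zero hq, lpN_zero _ hp]

end HajlaszPaper
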